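/- Let F be a division ring, Λ = {α₁,…,αₙ} a finite set, P_Λ its left minimal polynomial, and suppose pᵢ^ℓ(αᵢ) ≠ 0 where pᵢ is the left minimal polynomial of Λ∖{αᵢ}. Then P_Λ = pᵢ · (z − α̃ᵢ), where α̃ᵢ = pᵢ^ℓ(αᵢ)⁻¹ αᵢ pᵢ^ℓ(αᵢ). -/

import Mathlib

open Polynomial

/-- Left evaluation of a polynomial `f = Σ zʲ fⱼ` at `a`: `f^ℓ(a) = Σ aʲ fⱼ`.
(Mathlib's `Polynomial.eval` is the right evaluation `Σ fⱼ aʲ`.) -/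
noncomputable def lEval {F : Type*} [DivisionRing F] (a : F) (f : F[X]) : F :=
  f.sum fun j c => a ^ j * c

/-- p is the left minimal polynomial of Δ: the monic generator of the right ideal
of polynomials left-vanishing on Δ. -/
def IsLeftMinPoly {F : Type*} [DivisionRing F] (Δ : Set F) (p : F[X]) : Prop :=
  p.Monic ∧ (∀ a ∈ Δ, lEval a p = 0) ∧
    ∀ f : F[X], (∀ a ∈ Δ, lEval a f = 0) → ∃ h : F[X], f = p * h

section LeftEvaluation

variable {F : Type*} [DivisionRing F]

theorem lEval_add (a : F) (f g : F[X]) : lEval a (f + g) = lEval a f + lEval a g :=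
  sum_add_index f g _ (fun _ => mul_zero _) fun _ _ _ => mul_add _ _ _

theorem lEval_monomial (a : F) (n : ℕ) (c : F) : lEval a (monomial n c) = a ^ n * c :=
  sum_monomial_index c _ (mul_zero _)

theorem lEval_mul_X (a : F) (f : F[X]) : lEval a (f * X) = a * lEval a f := by
  induction f using Polynomial.induction_on' with
  | add f g hf hg => rw [add_mul, lEval_add, lEval_add, hf, hg, mul_add]
  | monomial n c => rw [monomial_mul_X, lEval_monomial, lEval_monomial, pow_succ', mul_assoc]

theorem lEval_mul_C (a b : F) (f : F[X]) : lEval a (f * C b) = lEval a f * b := by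
  induction f using Polynomial.induction_on' with
  | add f g hf hg => rw [add_mul, lEval_add, lEval_add, hf, hg, add_mul]
  | monomial n c => rw [monomial_mul_C, lEval_monomial, lEval_monomial, mul_assoc]

theorem lEval_mul_X_sub_C (a b : F) (f : F[X]) :
    lEval a (f * (X - C b)) = a * lEval a f - lEval a f * b := by
  rw [sub_eq_add_neg, ← C_neg, mul_add, lEval_add, lEval_mul_X, lEval_mul_C, mul_neg,
    sub_eq_add_neg]

end LeftEvaluation

/-- Factorization of the left minimal polynomial:
P_Λ = pᵢ·(z − α̃ᵢ) with α̃ᵢ = pᵢ^ℓ(αᵢ)⁻¹ αᵢ pᵢ^ℓ(αᵢ). -/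
theorem stmt10 {F : Type*} [DivisionRing F] (n : ℕ) (α : Fin n → F)
    (hα : Function.Injective α) (P : F[X])
    (hP : IsLeftMinPoly (Set.range α) P) (hdeg : P.natDegree = n)
    (p : Fin n → F[X])
    (hp : ∀ i, IsLeftMinPoly {x | ∃ j, j ≠ i ∧ x = α j} (p i))
    (hne : ∀ i, lEval (α i) (p i) ≠ 0) :
    ∀ i, P = p i * (X - C ((lEval (α i) (p i))⁻¹ * α i * lEval (α i) (p i))) := by
  intro i
  set c := lEval (α i) (p i) with hc
  have hc0 : c ≠ 0 := hne i
  obtain ⟨hpm, hpz, hpd⟩ := hp i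
  obtain ⟨hPm, hPz, hPd⟩ := hP
  obtain ⟨k, hk⟩ := hpd P (by
    rintro _ ⟨j, -, rfl⟩
    exact hPz _ ⟨j, rfl⟩)
  obtain ⟨h, hh⟩ := hPd (p i * (X - C (c⁻¹ * α i * c))) (by
    rintro _ ⟨j, rfl⟩
    rw [lEval_mul_X_sub_C]
    rcases eq_or_ne j i with rfl | hj
    · rw [← hc, mul_assoc, mul_inv_cancel_left₀ hc0, sub_self]
    · rw [hpz _ ⟨j, hj, rfl⟩, mul_zero, zero_mul, sub_zero])
  have hkm : k.Monic := hpm.of_mul_monic_left (hk ▸ hPm)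
  have hhm : h.Monic := hPm.of_mul_monic_left (hh ▸ hpm.mul (monic_X_sub_C _))
  have hk1 : k ≠ 1 := by
    rintro rfl
    rw [mul_one] at hk
    exact hc0 (by rw [hc, ← hk]; exact hPz _ ⟨i, rfl⟩)
  have hkh : X - C (c⁻¹ * α i * c) = k * h :=
    mul_left_cancel₀ hpm.ne_zero (by rw [hh, hk, mul_assoc])
  have hdeg_kh : k.natDegree + h.natDegree = 1 := by
    rw [← hkm.natDegree_mul hhm, ← hkh, natDegree_X_sub_C]
  have hk0 : k.natDegree ≠ 0 := fun h0 => hk1 (hkm.natDegree_eq_zero.mp h0)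
  have hh1 : h = 1 := hhm.natDegree_eq_zero.mp (by omega)
  rw [hh, hh1, mul_one]
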